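/- For ℤ-indexed chain complexes V and W of ℚ-vector spaces there is a bijection, natural in V and W, between the set of chain maps Σ̂V → W and the set of chain maps V → Ω̂W. (The unreduced double-cone suspension Σ̂ is left adjoint to the unreduced double-path loops Ω̂ on rational chain complexes.) -/

import Mathlib

set_option autoImplicit false

/-- A `ℤ`-indexed graded `ℚ`-vector space equipped with a degree `-1` linear map
(the underlying data of a chain complex). -/
structure PreDG where
  V : ℤ → Type
  [grp : ∀ n, AddCommGroup (V n)]
  [mod : ∀ n, Module ℚ (V n)]
  d : ∀ n : ℤ, V n →ₗ[ℚ] V (n - 1)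

attribute [instance] PreDG.grp PreDG.mod

/-- A chain complex of `ℚ`-vector spaces: the differential squares to zero. -/
structure DG extends PreDG where
  dd : ∀ (n : ℤ) (x : V n), d (n - 1) (d n x) = 0

namespace PreDG

/-- Transport along an equality of degrees. -/
def castV (A : PreDG) : ∀ {m n : ℤ}, m = n → (A.V m →ₗ[ℚ] A.V n)
  | _, _, rfl => LinearMap.id

/-- A chain map: a family of degree-0 linear maps commuting with the differentials. -/
structure Hom (A B : PreDG) where
  f : ∀ n : ℤ, A.V n →ₗ[ℚ] B.V n
  comm : ∀ (n : ℤ) (x : A.V n), f (n - 1) (A.d n x) = B.d n (f n x)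

theorem Hom.cast_comm {A B : PreDG} (φ : Hom A B) {m n : ℤ} (h : m = n) (x : A.V m) :
    φ.f n (A.castV h x) = B.castV h (φ.f m x) := by subst h; rfl

/-- The `n`-th term of the double-cone suspension `Σ̂A`: `A_{n-1} ⊕ A_n ⊕ A_{n-1}`. -/
abbrev hatSigmaV (A : PreDG) (n : ℤ) : Type := A.V (n - 1) × A.V n × A.V (n - 1)

/-- The differential of `Σ̂A`: `d (v₁, v₂, v₃) = (-d v₁, d v₂ + v₁ + v₃, -d v₃)`. -/
def hatSigmaD (A : PreDG) (n : ℤ) : hatSigmaV A n →ₗ[ℚ] hatSigmaV A (n - 1) :=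
  LinearMap.prod
    (-((A.d (n - 1)).comp (LinearMap.fst ℚ (A.V (n - 1)) (A.V n × A.V (n - 1)))))
    (LinearMap.prod
      ((A.d n).comp ((LinearMap.fst ℚ (A.V n) (A.V (n - 1))).comp
          (LinearMap.snd ℚ (A.V (n - 1)) (A.V n × A.V (n - 1))))
        + LinearMap.fst ℚ (A.V (n - 1)) (A.V n × A.V (n - 1))
        + (LinearMap.snd ℚ (A.V n) (A.V (n - 1))).comp
            (LinearMap.snd ℚ (A.V (n - 1)) (A.V n × A.V (n - 1))))
      (-((A.d (n - 1)).comp ((LinearMap.snd ℚ (A.V n) (A.V (n - 1))).comp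
          (LinearMap.snd ℚ (A.V (n - 1)) (A.V n × A.V (n - 1)))))))

theorem hatSigmaD_apply (A : PreDG) (n : ℤ) (v₁ : A.V (n - 1)) (v₂ : A.V n)
    (v₃ : A.V (n - 1)) :
    hatSigmaD A n (v₁, v₂, v₃)
      = (-(A.d (n - 1) v₁), A.d n v₂ + v₁ + v₃, -(A.d (n - 1) v₃)) := rfl

/-- The double-cone suspension `Σ̂A` (as a graded vector space with degree `-1` map). -/
def hatSigmaPre (A : PreDG) : PreDG where
  V := hatSigmaV A
  grp := fun _ => inferInstance
  mod := fun _ => inferInstance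
  d := hatSigmaD A


/-- The `n`-th term of the double-path loops `Ω̂A`: `A_{n+1} × A_n × A_{n+1}`. -/
abbrev hatOmegaV (A : PreDG) (n : ℤ) : Type := A.V (n + 1) × A.V n × A.V (n + 1)

/-- The differential of `Ω̂A`: `d (v₁, v₂, v₃) = (-d v₁ + v₂, d v₂, -d v₃ + v₂)`. -/
def hatOmegaD (A : PreDG) (n : ℤ) : hatOmegaV A n →ₗ[ℚ] hatOmegaV A (n - 1) :=
  LinearMap.prod
    ((A.castV (show n + 1 - 1 = n - 1 + 1 by omega)).comp
        (-((A.d (n + 1)).comp (LinearMap.fst ℚ (A.V (n + 1)) (A.V n × A.V (n + 1)))))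
      + (A.castV (show n = n - 1 + 1 by omega)).comp
          ((LinearMap.fst ℚ (A.V n) (A.V (n + 1))).comp
            (LinearMap.snd ℚ (A.V (n + 1)) (A.V n × A.V (n + 1)))))
    (LinearMap.prod
      ((A.d n).comp ((LinearMap.fst ℚ (A.V n) (A.V (n + 1))).comp
          (LinearMap.snd ℚ (A.V (n + 1)) (A.V n × A.V (n + 1)))))
      ((A.castV (show n + 1 - 1 = n - 1 + 1 by omega)).comp
          (-((A.d (n + 1)).comp ((LinearMap.snd ℚ (A.V n) (A.V (n + 1))).comp
              (LinearMap.snd ℚ (A.V (n + 1)) (A.V n × A.V (n + 1))))))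
        + (A.castV (show n = n - 1 + 1 by omega)).comp
            ((LinearMap.fst ℚ (A.V n) (A.V (n + 1))).comp
              (LinearMap.snd ℚ (A.V (n + 1)) (A.V n × A.V (n + 1))))))

theorem hatOmegaD_apply (A : PreDG) (n : ℤ) (v₁ : A.V (n + 1)) (v₂ : A.V n)
    (v₃ : A.V (n + 1)) :
    hatOmegaD A n (v₁, v₂, v₃)
      = (A.castV (show n + 1 - 1 = n - 1 + 1 by omega) (-(A.d (n + 1) v₁))
           + A.castV (show n = n - 1 + 1 by omega) v₂,
         A.d n v₂,
         A.castV (show n + 1 - 1 = n - 1 + 1 by omega) (-(A.d (n + 1) v₃))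
           + A.castV (show n = n - 1 + 1 by omega) v₂) := rfl

/-- The double-path loops `Ω̂A` (as a graded vector space with degree `-1` map). -/
def hatOmegaPre (A : PreDG) : PreDG where
  V := hatOmegaV A
  grp := fun _ => inferInstance
  mod := fun _ => inferInstance
  d := hatOmegaD A


/-- Composition of chain maps. -/
def Hom.comp {A B C : PreDG} (g : Hom B C) (f : Hom A B) : Hom A C where
  f n := (g.f n).comp (f.f n)
  comm n x := by
    simp only [LinearMap.comp_apply]
    rw [f.comm, g.comm]

/-- The functorial action of the double-cone suspension on chain maps. -/
def hatSigmaHom {A B : PreDG} (α : Hom A B) : Hom (hatSigmaPre A) (hatSigmaPre B) where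
  f n := (α.f (n - 1)).prodMap ((α.f n).prodMap (α.f (n - 1)))
  comm n x := by
    show (α.f (n - 1 - 1) (-(A.d (n - 1) x.1)),
          α.f (n - 1) (A.d n x.2.1 + x.1 + x.2.2),
          α.f (n - 1 - 1) (-(A.d (n - 1) x.2.2)))
       = (-(B.d (n - 1) (α.f (n - 1) x.1)),
          B.d n (α.f n x.2.1) + α.f (n - 1) x.1 + α.f (n - 1) x.2.2,
          -(B.d (n - 1) (α.f (n - 1) x.2.2)))
    simp only [map_add, map_neg, α.comm]

/-- The functorial action of the double-path loops on chain maps. -/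
def hatOmegaHom {A B : PreDG} (β : Hom A B) : Hom (hatOmegaPre A) (hatOmegaPre B) where
  f n := (β.f (n + 1)).prodMap ((β.f n).prodMap (β.f (n + 1)))
  comm n x := by
    show (β.f (n - 1 + 1) (A.castV (show n + 1 - 1 = n - 1 + 1 by omega) (-(A.d (n + 1) x.1))
            + A.castV (show n = n - 1 + 1 by omega) x.2.1),
          β.f (n - 1) (A.d n x.2.1),
          β.f (n - 1 + 1) (A.castV (show n + 1 - 1 = n - 1 + 1 by omega) (-(A.d (n + 1) x.2.2))
            + A.castV (show n = n - 1 + 1 by omega) x.2.1))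
       = (B.castV (show n + 1 - 1 = n - 1 + 1 by omega) (-(B.d (n + 1) (β.f (n + 1) x.1)))
            + B.castV (show n = n - 1 + 1 by omega) (β.f n x.2.1),
          B.d n (β.f n x.2.1),
          B.castV (show n + 1 - 1 = n - 1 + 1 by omega) (-(B.d (n + 1) (β.f (n + 1) x.2.2)))
            + B.castV (show n = n - 1 + 1 by omega) (β.f n x.2.1))
    simp only [map_add, map_neg, Hom.cast_comm, β.comm]

end PreDG

namespace PreDG

theorem Hom.ext_f {A B : PreDG} {φ ψ : Hom A B} (h : ∀ n x, φ.f n x = ψ.f n x) : φ = ψ := by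
  cases φ; cases ψ
  congr
  funext n
  exact LinearMap.ext (h n)

theorem castV_castV (A : PreDG) {m n k : ℤ} (h : m = n) (h' : n = k) (x : A.V m) :
    A.castV h' (A.castV h x) = A.castV (h.trans h') x := by subst h; subst h'; rfl

theorem castV_rfl (A : PreDG) {m : ℤ} (h : m = m) (x : A.V m) : A.castV h x = x := rfl

theorem d_castV (A : PreDG) {m n : ℤ} (h : m = n) (x : A.V m) :
    A.d n (A.castV h x) = A.castV (show m - 1 = n - 1 by omega) (A.d m x) := by
  subst h; rfl

/-- Three-fold injection into the suspension. -/
def sg (A : PreDG) (n : ℤ) (x : A.V (n - 1)) (y : A.V n) (z : A.V (n - 1)) :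
    (hatSigmaPre A).V n := (x, y, z)

theorem castV_sg (A : PreDG) {m n : ℤ} (h : m = n) (x : A.V (m - 1)) (y : A.V m)
    (z : A.V (m - 1)) :
    (hatSigmaPre A).castV h (sg A m x y z)
      = sg A n (A.castV (by omega) x) (A.castV h y) (A.castV (by omega) z) := by
  subst h; rfl

theorem d_sg (A : PreDG) (n : ℤ) (x : A.V (n - 1)) (y : A.V n) (z : A.V (n - 1)) :
    (hatSigmaPre A).d n (sg A n x y z)
      = sg A (n - 1) (-(A.d (n - 1) x)) (A.d n y + x + z) (-(A.d (n - 1) z)) := rfl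

theorem sg_add (A : PreDG) (n : ℤ) (x x' : A.V (n - 1)) (y y' : A.V n) (z z' : A.V (n - 1)) :
    sg A n x y z + sg A n x' y' z' = sg A n (x + x') (y + y') (z + z') := rfl

theorem sg_neg (A : PreDG) (n : ℤ) (x : A.V (n - 1)) (y : A.V n) (z : A.V (n - 1)) :
    -sg A n x y z = sg A n (-x) (-y) (-z) := rfl

/-- The transpose of a chain map out of the suspension. -/
def toOmega {A B : PreDG} (φ : Hom (hatSigmaPre A) B) : Hom A (hatOmegaPre B) where
  f n :=
    { toFun := fun v =>
        ((φ.f (n + 1) (sg A (n + 1) (A.castV (by omega) v) 0 0),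
          φ.f n (sg A n 0 v 0),
          φ.f (n + 1) (sg A (n + 1) 0 0 (A.castV (by omega) v))) : hatOmegaV B n)
      map_add' := fun x y => by
        show ((_, _, _) : hatOmegaV B n) = (_ + _, _ + _, _ + _)
        simp only [← map_add, sg_add, add_zero]
      map_smul' := fun c x => by
        show ((_, _, _) : hatOmegaV B n) = (c • _, c • _, c • _)
        simp only [← map_smul]
        have h : ∀ (k : ℤ) (x : A.V (k - 1)) (y : A.V k) (z : A.V (k - 1)),
          c • sg A k x y z = sg A k (c • x) (c • y) (c • z) := fun _ _ _ _ => rfl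
        simp only [h, smul_zero, map_smul] }
  comm n v := by
    show ((_, _, _) : hatOmegaV B (n - 1)) =
      (B.castV (show n + 1 - 1 = n - 1 + 1 by omega) (-(B.d (n + 1) (φ.f (n + 1) _)))
            + B.castV (show n = n - 1 + 1 by omega) (φ.f n _),
          B.d n (φ.f n _),
          B.castV (show n + 1 - 1 = n - 1 + 1 by omega) (-(B.d (n + 1) (φ.f (n + 1) _)))
            + B.castV (show n = n - 1 + 1 by omega) (φ.f n _))
    simp only [← φ.comm, d_sg, ← map_neg, sg_neg, ← φ.cast_comm, castV_sg, ← map_add, sg_add,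
      d_castV, castV_castV]
    simp [castV_castV]

/-- First component of a map into the loops. -/
def p1 {A B : PreDG} (ψ : Hom A (hatOmegaPre B)) (n : ℤ) : A.V n →ₗ[ℚ] B.V (n + 1) :=
  (LinearMap.fst ℚ (B.V (n + 1)) (B.V n × B.V (n + 1))).comp (ψ.f n)

/-- Second component of a map into the loops. -/
def p2 {A B : PreDG} (ψ : Hom A (hatOmegaPre B)) (n : ℤ) : A.V n →ₗ[ℚ] B.V n :=
  (LinearMap.fst ℚ (B.V n) (B.V (n + 1))).comp
    ((LinearMap.snd ℚ (B.V (n + 1)) (B.V n × B.V (n + 1))).comp (ψ.f n))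

/-- Third component of a map into the loops. -/
def p3 {A B : PreDG} (ψ : Hom A (hatOmegaPre B)) (n : ℤ) : A.V n →ₗ[ℚ] B.V (n + 1) :=
  (LinearMap.snd ℚ (B.V n) (B.V (n + 1))).comp
    ((LinearMap.snd ℚ (B.V (n + 1)) (B.V n × B.V (n + 1))).comp (ψ.f n))

theorem p1_d {A B : PreDG} (ψ : Hom A (hatOmegaPre B)) (n : ℤ) (v : A.V n) :
    p1 ψ (n - 1) (A.d n v)
      = B.castV (show n + 1 - 1 = n - 1 + 1 by omega) (-(B.d (n + 1) (p1 ψ n v)))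
        + B.castV (show n = n - 1 + 1 by omega) (p2 ψ n v) :=
  congrArg (fun t : hatOmegaV B (n - 1) => t.1) (ψ.comm n v)

theorem p2_d {A B : PreDG} (ψ : Hom A (hatOmegaPre B)) (n : ℤ) (v : A.V n) :
    p2 ψ (n - 1) (A.d n v) = B.d n (p2 ψ n v) :=
  congrArg (fun t : hatOmegaV B (n - 1) => t.2.1) (ψ.comm n v)

theorem p3_d {A B : PreDG} (ψ : Hom A (hatOmegaPre B)) (n : ℤ) (v : A.V n) :
    p3 ψ (n - 1) (A.d n v)
      = B.castV (show n + 1 - 1 = n - 1 + 1 by omega) (-(B.d (n + 1) (p3 ψ n v)))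
        + B.castV (show n = n - 1 + 1 by omega) (p2 ψ n v) :=
  congrArg (fun t : hatOmegaV B (n - 1) => t.2.2) (ψ.comm n v)

theorem p1_cast {A B : PreDG} (ψ : Hom A (hatOmegaPre B)) {m n : ℤ} (h : m = n) (v : A.V m) :
    p1 ψ n (A.castV h v) = B.castV (by omega) (p1 ψ m v) := by subst h; rfl

theorem p3_cast {A B : PreDG} (ψ : Hom A (hatOmegaPre B)) {m n : ℤ} (h : m = n) (v : A.V m) :
    p3 ψ n (A.castV h v) = B.castV (by omega) (p3 ψ m v) := by subst h; rfl

/-- The transpose of a chain map into the loops. -/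
def ofOmega {A B : PreDG} (ψ : Hom A (hatOmegaPre B)) : Hom (hatSigmaPre A) B where
  f n := ((B.castV (show n - 1 + 1 = n by omega)).comp (p1 ψ (n - 1))).coprod
    ((p2 ψ n).coprod ((B.castV (show n - 1 + 1 = n by omega)).comp (p3 ψ (n - 1))))
  comm n v := by
    obtain ⟨x, y, z⟩ := v
    show B.castV _ (p1 ψ (n - 1 - 1) (-(A.d (n - 1) x)))
        + (p2 ψ (n - 1) (A.d n y + x + z) + B.castV _ (p3 ψ (n - 1 - 1) (-(A.d (n - 1) z))))
      = B.d n (B.castV _ (p1 ψ (n - 1) x) + (p2 ψ n y + B.castV _ (p3 ψ (n - 1) z)))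
    simp only [map_add, map_neg, p1_d, p2_d, p3_d, castV_castV, d_castV, castV_rfl]
    abel

theorem ofOmega_sg {A B : PreDG} (ψ : Hom A (hatOmegaPre B)) (n : ℤ) (x : A.V (n - 1))
    (y : A.V n) (z : A.V (n - 1)) :
    (ofOmega ψ).f n (sg A n x y z)
      = B.castV (show n - 1 + 1 = n by omega) (p1 ψ (n - 1) x)
        + (p2 ψ n y + B.castV (show n - 1 + 1 = n by omega) (p3 ψ (n - 1) z)) := rfl

/-- The adjunction bijection. -/
def adjEquiv (A B : PreDG) : Hom (hatSigmaPre A) B ≃ Hom A (hatOmegaPre B) where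
  toFun := toOmega
  invFun := ofOmega
  left_inv φ := by
    apply Hom.ext_f
    rintro n ⟨x, y, z⟩
    show B.castV _ (φ.f (n - 1 + 1) (sg A (n - 1 + 1) (A.castV _ x) 0 0))
        + (φ.f n (sg A n 0 y 0)
          + B.castV _ (φ.f (n - 1 + 1) (sg A (n - 1 + 1) 0 0 (A.castV _ z))))
      = φ.f n (sg A n x y z)
    simp only [← φ.cast_comm, castV_sg, castV_castV, castV_rfl, map_zero]
    rw [← map_add, ← map_add, sg_add, sg_add]
    simp only [add_zero, zero_add]
  right_inv ψ := by
    apply Hom.ext_f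
    intro n v
    show (((ofOmega ψ).f (n + 1) (sg A (n + 1) (A.castV _ v) 0 0),
          (ofOmega ψ).f n (sg A n 0 v 0),
          (ofOmega ψ).f (n + 1) (sg A (n + 1) 0 0 (A.castV _ v))) : hatOmegaV B n)
        = (p1 ψ n v, p2 ψ n v, p3 ψ n v)
    simp only [ofOmega_sg, p1_cast, p3_cast, castV_castV, castV_rfl, map_zero, add_zero, zero_add]

end PreDG

open PreDG

/-- For rational chain complexes `V` and `W` there is a bijection,
natural in `V` and `W`, between chain maps `Σ̂V → W` and chain maps `V → Ω̂W`:
the unreduced double-cone suspension is left adjoint to the unreduced double-path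
loops. -/
theorem hatSigma_left_adjoint_to_hatOmega :
    ∃ e : ∀ (V W : DG),
        Hom (hatSigmaPre V.toPreDG) W.toPreDG ≃ Hom V.toPreDG (hatOmegaPre W.toPreDG),
      (∀ (V V' W : DG) (α : Hom V'.toPreDG V.toPreDG)
          (φ : Hom (hatSigmaPre V.toPreDG) W.toPreDG),
          e V' W (φ.comp (hatSigmaHom α)) = (e V W φ).comp α) ∧
      (∀ (V W W' : DG) (β : Hom W.toPreDG W'.toPreDG)
          (φ : Hom (hatSigmaPre V.toPreDG) W.toPreDG),
          e V W' (β.comp φ) = (hatOmegaHom β).comp (e V W φ)) := by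
  refine ⟨fun V W => adjEquiv V.toPreDG W.toPreDG, ?_, ?_⟩
  · intro V V' W α φ
    apply Hom.ext_f
    intro n v
    show ((φ.f (n + 1) (sg _ (n + 1) (α.f _ (V'.castV _ v)) (α.f _ 0) (α.f _ 0)),
        φ.f n (sg _ n (α.f _ 0) (α.f n v) (α.f _ 0)),
        φ.f (n + 1) (sg _ (n + 1) (α.f _ 0) (α.f _ 0) (α.f _ (V'.castV _ v)))) :
          hatOmegaV W.toPreDG n)
      = (φ.f (n + 1) (sg _ (n + 1) (V.castV _ (α.f n v)) 0 0),
        φ.f n (sg _ n 0 (α.f n v) 0),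
        φ.f (n + 1) (sg _ (n + 1) 0 0 (V.castV _ (α.f n v))))
    simp only [map_zero, α.cast_comm]
  · intro V W W' β φ
    rfl
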